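/- Let g and h be positive definite Hermitian n×n complex matrices, and let q = h·(g+h)⁻¹·g·(g+h)⁻¹·h + g·(g+h)⁻¹·h·(g+h)⁻¹·g. Then (g+h) − q is positive semidefinite, i.e. q ≤ g + h in the Loewner order. -/

import Mathlib

open Matrix ComplexOrder

/-- If `p` is a two-sided inverse of `g + h`, then `(g + h) - q` simplifies to `h + g * p * g`. -/
theorem add_sub_quotient_eq {R : Type*} [Ring R] {g h p : R}
    (hl : p * (g + h) = 1) (hr : (g + h) * p = 1) :
    (g + h) - (h * p * g * p * h + g * p * h * p * g) = h + g * p * g := by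
  have hph : p * h = 1 - p * g := by rw [← hl]; noncomm_ring
  have hhp : h * p = 1 - g * p := by rw [← hr]; noncomm_ring
  have gph : g * p * h = g - g * p * g := by rw [mul_assoc, hph]; noncomm_ring
  have hpg : h * p * g = g * p * h := by rw [gph, hhp]; noncomm_ring
  have hq : h * p * g * p * h + g * p * h * p * g = g * p * h := by
    rw [hpg]
    calc g * p * h * p * h + g * p * h * p * g = g * p * h * (p * (g + h)) := by noncomm_ring
      _ = g * p * h := by rw [hl, mul_one]
  rw [hq, gph]
  noncomm_ring

theorem quotient_metric_le_sum {n : ℕ} (g h : Matrix (Fin n) (Fin n) ℂ)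
    (hg : g.PosDef) (hh : h.PosDef) :
    ((g + h) - (h * (g + h)⁻¹ * g * (g + h)⁻¹ * h + g * (g + h)⁻¹ * h * (g + h)⁻¹ * g)).PosSemidef := by
  have hs : (g + h).PosDef := hg.add hh
  have hdet : IsUnit (g + h).det := (isUnit_iff_isUnit_det _).mp hs.isUnit
  rw [add_sub_quotient_eq (nonsing_inv_mul _ hdet) (mul_nonsing_inv _ hdet)]
  have hgpg := hs.inv.posSemidef.conjTranspose_mul_mul_same g
  rw [hg.isHermitian.eq] at hgpg
  exact hh.posSemidef.add hgpg
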